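/- Let σ > 0, b* = (σ+1)^{1+1/σ}/σ, and for a positive integer k define g_k(x) = x^{−1/σ} + x·(1/x − k)^{−1/σ} + (1 − k x)·b* for x ∈ (1/(k+1), 1/k). Then for every irrational x in the cylinder (1/(k+1), 1/k), one has B_σ(x) ≥ g_k(x). -/

import Mathlib

open Real Set MeasureTheory
open scoped ENNReal

/-- The Gauss map `A(x) = 1/x - ⌊1/x⌋`. -/
noncomputable def gaussMap (x : ℝ) : ℝ := 1 / x - (⌊1 / x⌋ : ℝ)

/-- `brjunoBeta x j = β_{j-1}(x) = ∏_{i=0}^{j-1} A^i(x)`; in particular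
`brjunoBeta x 0 = β_{-1}(x) = 1` and `β_K(x) = brjunoBeta x (K+1)`. -/
noncomputable def brjunoBeta (x : ℝ) (j : ℕ) : ℝ := ∏ i ∈ Finset.range j, gaussMap^[i] x

/-- The σ-Brjuno function `B_σ(x) = Σ_{j≥0} β_{j-1}(x) · (A^j x)^{-1/σ}`, valued in `[0,+∞]`. -/
noncomputable def brjuno (σ x : ℝ) : ℝ≥0∞ :=
  ∑' j : ℕ, ENNReal.ofReal (brjunoBeta x j * (gaussMap^[j] x) ^ (-(1 / σ)))

/-- The K-th partial sum `B_σ^{(K)}(x) = Σ_{j=0}^{K} β_{j-1}(x) · (A^j x)^{-1/σ}`. -/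
noncomputable def brjunoPartial (σ x : ℝ) (K : ℕ) : ℝ :=
  ∑ j ∈ Finset.range (K + 1), brjunoBeta x j * (gaussMap^[j] x) ^ (-(1 / σ))

/-- The fixed point `η_m = (√(m²+4) − m)/2 = [0; m, m, m, ...]` of the Gauss map. -/
noncomputable def eta (m : ℕ) : ℝ := (Real.sqrt ((m : ℝ) ^ 2 + 4) - m) / 2

/-- `b* = (σ+1)^{1+1/σ}/σ`. -/
noncomputable def bstar (σ : ℝ) : ℝ := (σ + 1) ^ (1 + 1 / σ) / σ

/-- The global lower bound `g(x) = x^{-1/σ} + b*·x`. -/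
noncomputable def gLow (σ x : ℝ) : ℝ := x ^ (-(1 / σ)) + bstar σ * x

/-- The cylinder lower bound `g_k(x) = x^{-1/σ} + x·(1/x − k)^{-1/σ} + (1 − kx)·b*`. -/
noncomputable def gCyl (σ : ℝ) (k : ℕ) (x : ℝ) : ℝ :=
  x ^ (-(1 / σ)) + x * (1 / x - (k : ℝ)) ^ (-(1 / σ)) + (1 - (k : ℝ) * x) * bstar σ

/-- The Gauss map sends irrational numbers to irrational points of the unit interval. -/
theorem gaussMap_irrational_mem {x : ℝ} (hx : Irrational x) :
    Irrational (gaussMap x) ∧ gaussMap x ∈ Ioo (0 : ℝ) 1 := by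
  have h : Irrational (gaussMap x) := by
    unfold gaussMap
    rw [one_div]
    exact hx.inv.sub_intCast _
  refine ⟨h, lt_of_le_of_ne ?_ h.ne_zero.symm, ?_⟩
  · exact Int.fract_nonneg (1 / x)
  · exact Int.fract_lt_one (1 / x)

theorem iterate_gaussMap_irrational_mem {x : ℝ} (hx : Irrational x) (h01 : x ∈ Ioo (0 : ℝ) 1)
    (j : ℕ) : Irrational (gaussMap^[j] x) ∧ gaussMap^[j] x ∈ Ioo (0 : ℝ) 1 := by
  induction j with
  | zero => exact ⟨hx, h01⟩
  | succ j ih =>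
    rw [Function.iterate_succ_apply']
    exact gaussMap_irrational_mem ih.1

theorem mul_gaussMap_le_half {x : ℝ} (hx : x ∈ Ioo (0 : ℝ) 1) : x * gaussMap x ≤ 1 / 2 := by
  obtain ⟨h0, h1⟩ := hx
  have hfl : (1 : ℝ) ≤ (⌊1 / x⌋ : ℝ) := by
    have : (1 : ℤ) ≤ ⌊1 / x⌋ := Int.le_floor.2 (by
      push_cast
      exact (one_lt_one_div h0 h1).le)
    exact_mod_cast this
  have hlt : 1 / x < (⌊1 / x⌋ : ℝ) + 1 := Int.lt_floor_add_one _
  have hinv : x * (1 / x) = 1 := mul_one_div_cancel h0.ne'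
  have hmul := mul_lt_mul_of_pos_left hlt h0
  unfold gaussMap
  nlinarith

theorem brjunoBeta_nonneg {x : ℝ} (hx : Irrational x) (h01 : x ∈ Ioo (0 : ℝ) 1) (j : ℕ) :
    0 ≤ brjunoBeta x j :=
  Finset.prod_nonneg fun i _ => (iterate_gaussMap_irrational_mem hx h01 i).2.1.le

theorem brjunoBeta_succ (x : ℝ) (j : ℕ) :
    brjunoBeta x (j + 1) = brjunoBeta x j * gaussMap^[j] x :=
  Finset.prod_range_succ _ _

theorem brjunoBeta_succ' (x : ℝ) (j : ℕ) :
    brjunoBeta x (j + 1) = x * brjunoBeta (gaussMap x) j := by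
  simp [brjunoBeta, Finset.prod_range_succ', mul_comm]

theorem brjunoBeta_two_mul_le {x : ℝ} (hx : Irrational x) (h01 : x ∈ Ioo (0 : ℝ) 1) (n : ℕ) :
    brjunoBeta x (2 * n) ≤ (1 / 2) ^ n := by
  induction n with
  | zero => simp [brjunoBeta]
  | succ n ih =>
    have h := mul_gaussMap_le_half (iterate_gaussMap_irrational_mem hx h01 (2 * n)).2
    have hβ := brjunoBeta_nonneg hx h01 (2 * n)
    rw [show 2 * (n + 1) = 2 * n + 1 + 1 by ring, brjunoBeta_succ, brjunoBeta_succ,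
      Function.iterate_succ_apply', mul_assoc, pow_succ]
    exact (mul_le_mul_of_nonneg_left h hβ).trans (mul_le_mul_of_nonneg_right ih (by norm_num))

/-- The tangent line of `t ↦ t ^ (-s)` at `1` lies below the graph. -/
theorem one_sub_mul_le_rpow_neg {s t : ℝ} (hs : 0 ≤ s) (ht : 0 < t) :
    1 - s * (t - 1) ≤ t ^ (-s) := by
  rw [rpow_def_of_pos ht]
  have h1 := add_one_le_exp (log t * -s)
  have h2 := mul_le_mul_of_nonneg_left (log_le_sub_one_of_pos ht) hs
  linarith

theorem bstar_pos {σ : ℝ} (hσ : 0 < σ) : 0 < bstar σ := by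
  unfold bstar
  positivity

theorem bstar_mul_one_sub_le_rpow {σ x : ℝ} (hσ : 0 < σ) (hx : 0 < x) :
    bstar σ * (1 - x) ≤ x ^ (-(1 / σ)) := by
  have hσ1 : 0 < σ + 1 := by linarith
  have h := one_sub_mul_le_rpow_neg (one_div_pos.2 hσ).le (mul_pos hσ1 hx)
  rw [mul_rpow hσ1.le hx.le] at h
  have hpow := mul_le_mul_of_nonneg_left h (rpow_pos_of_pos hσ1 (1 / σ)).le
  rw [← mul_assoc, ← rpow_add hσ1, add_neg_cancel, rpow_zero, one_mul] at hpow
  refine le_trans (le_of_eq ?_) hpow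
  rw [bstar, rpow_add hσ1, rpow_one]
  field_simp
  ring

theorem bstar_mul_one_sub_brjunoBeta_le {σ x : ℝ} (hσ : 0 < σ) (hx : Irrational x)
    (h01 : x ∈ Ioo (0 : ℝ) 1) (n : ℕ) :
    bstar σ * (1 - brjunoBeta x n) ≤
      ∑ j ∈ Finset.range n, brjunoBeta x j * (gaussMap^[j] x) ^ (-(1 / σ)) := by
  induction n with
  | zero => simp [brjunoBeta]
  | succ n ih =>
    have h := mul_le_mul_of_nonneg_left (bstar_mul_one_sub_le_rpow hσ
      (iterate_gaussMap_irrational_mem hx h01 n).2.1) (brjunoBeta_nonneg hx h01 n)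
    rw [Finset.sum_range_succ, brjunoBeta_succ]
    linarith

/-- The constant `b*` bounds the Brjuno function from below. -/
theorem ofReal_bstar_le_brjuno {σ x : ℝ} (hσ : 0 < σ) (hx : Irrational x)
    (h01 : x ∈ Ioo (0 : ℝ) 1) : ENNReal.ofReal (bstar σ) ≤ brjuno σ x := by
  have hbound (n : ℕ) :
      ENNReal.ofReal (bstar σ * (1 - (1 / 2) ^ n)) ≤ brjuno σ x := by
    have h := bstar_mul_one_sub_brjunoBeta_le hσ hx h01 (2 * n)
    have hβ := mul_le_mul_of_nonneg_left (brjunoBeta_two_mul_le hx h01 n) (bstar_pos hσ).le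
    refine (ENNReal.ofReal_le_ofReal (le_trans (by linarith) h)).trans ?_
    rw [ENNReal.ofReal_sum_of_nonneg fun j _ => mul_nonneg (brjunoBeta_nonneg hx h01 j)
      (rpow_nonneg (iterate_gaussMap_irrational_mem hx h01 j).2.1.le _)]
    exact ENNReal.sum_le_tsum _
  refine le_of_tendsto' (x := Filter.atTop) ?_ hbound
  refine ENNReal.tendsto_ofReal ?_
  have hpow : Filter.Tendsto (fun n : ℕ => (1 / 2 : ℝ) ^ n) Filter.atTop (nhds 0) :=
    tendsto_pow_atTop_nhds_zero_of_lt_one (by norm_num) (by norm_num)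
  simpa using (hpow.const_sub 1).const_mul (bstar σ)

/-- The functional equation `B_σ(x) = x^{-1/σ} + x · B_σ(A(x))`. -/
theorem brjuno_eq_add_mul (σ : ℝ) {x : ℝ} (hx : 0 ≤ x) :
    brjuno σ x =
      ENNReal.ofReal (x ^ (-(1 / σ))) + ENNReal.ofReal x * brjuno σ (gaussMap x) := by
  unfold brjuno
  rw [tsum_eq_zero_add' ENNReal.summable, ← ENNReal.tsum_mul_left]
  congr 1
  · simp [brjunoBeta]
  · refine tsum_congr fun j => ?_
    rw [brjunoBeta_succ', Function.iterate_succ_apply, mul_assoc, ENNReal.ofReal_mul hx]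

/-- The global lower bound `g ≤ B_σ`. -/
theorem ofReal_gLow_le_brjuno {σ x : ℝ} (hσ : 0 < σ) (hx : Irrational x)
    (h01 : x ∈ Ioo (0 : ℝ) 1) : ENNReal.ofReal (gLow σ x) ≤ brjuno σ x := by
  obtain ⟨hA, hA01⟩ := gaussMap_irrational_mem hx
  rw [brjuno_eq_add_mul σ h01.1.le, gLow, mul_comm (bstar σ)]
  refine ENNReal.ofReal_add_le.trans ?_
  rw [ENNReal.ofReal_mul h01.1.le]
  gcongr
  exact ofReal_bstar_le_brjuno hσ hA hA01

theorem gaussMap_eq_of_mem_cylinder {k : ℕ} (hk : 0 < k) {x : ℝ}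
    (hx : x ∈ Ioo (1 / ((k : ℝ) + 1)) (1 / (k : ℝ))) : gaussMap x = 1 / x - k := by
  have hk' : (0 : ℝ) < k := by exact_mod_cast hk
  have h0 : 0 < x := lt_trans (by positivity) hx.1
  have hfl : ⌊1 / x⌋ = (k : ℤ) := by
    rw [Int.floor_eq_iff]
    push_cast
    exact ⟨((lt_one_div hk' h0).2 hx.2).le, (one_div_lt (by positivity) h0).1 hx.1⟩
  rw [gaussMap, hfl, Int.cast_natCast]

/-- the cylinder lower bound `B_σ(x) ≥ g_k(x)` on `(1/(k+1), 1/k)`. -/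
theorem brjuno_cylinder_lower_bound (σ : ℝ) (hσ : 0 < σ) (k : ℕ) (hk : 0 < k) (x : ℝ)
    (hx : Irrational x) (hxk : x ∈ Set.Ioo (1 / ((k : ℝ) + 1)) (1 / (k : ℝ))) :
    ENNReal.ofReal (gCyl σ k x) ≤ brjuno σ x := by
  have h0 : 0 < x := lt_trans (by positivity) hxk.1
  obtain ⟨hA, hA01⟩ := gaussMap_irrational_mem hx
  have hsplit : gCyl σ k x = x ^ (-(1 / σ)) + x * gLow σ (gaussMap x) := by
    rw [gCyl, gLow, gaussMap_eq_of_mem_cylinder hk hxk]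
    have : x * (1 / x - k) = 1 - k * x := by field_simp
    linear_combination -bstar σ * this
  rw [hsplit, brjuno_eq_add_mul σ h0.le]
  refine ENNReal.ofReal_add_le.trans ?_
  rw [ENNReal.ofReal_mul h0.le]
  gcongr
  exact ofReal_gLow_le_brjuno hσ hA hA01
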